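/- Let α ∈ [1/2, 1), let E₁, E₂ be quantum channels from n×n to n×n complex matrices, and let E be any quantum channel from n×n to m×m complex matrices. Then the channel α-fidelity does not decrease under post-composition: 𝓕_α(E₁, E₂) ≤ 𝓕_α(E ∘ E₁, E ∘ E₂). -/

import Mathlib

open Matrix
open scoped Kronecker ComplexOrder

/-- Real power of a (Hermitian) matrix, defined by applying the real power function to the
eigenvalues via the spectral decomposition (functional calculus). -/
noncomputable def mpow {ι : Type*} [Fintype ι] [DecidableEq ι]
    (A : Matrix ι ι ℂ) (t : ℝ) : Matrix ι ι ℂ :=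
  if hA : A.IsHermitian then
    (hA.eigenvectorUnitary : Matrix ι ι ℂ) *
      Matrix.diagonal (fun i => ((hA.eigenvalues i ^ t : ℝ) : ℂ)) *
      star (hA.eigenvectorUnitary : Matrix ι ι ℂ)
  else 0

/-- The α-fidelity `F_α(ρ,σ) = tr[(σ^((1−α)/(2α)) ρ σ^((1−α)/(2α)))^α]`. -/
noncomputable def aFid {ι : Type*} [Fintype ι] [DecidableEq ι]
    (α : ℝ) (ρ σ : Matrix ι ι ℂ) : ℝ :=
  (Matrix.trace (mpow (mpow σ ((1 - α) / (2 * α)) * ρ * mpow σ ((1 - α) / (2 * α))) α)).re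

/-- A density matrix: positive semidefinite with trace 1. -/
def IsDensity {ι : Type*} [Fintype ι] (ρ : Matrix ι ι ℂ) : Prop :=
  ρ.PosSemidef ∧ ρ.trace = 1

/-- Partial trace over the second tensor factor. -/
noncomputable def ptrace2 {ι κ : Type*} [Fintype κ]
    (M : Matrix (ι × κ) (ι × κ) ℂ) : Matrix ι ι ℂ :=
  Matrix.of fun i j => ∑ k : κ, M (i, k) (j, k)

/-- A quantum channel: a map admitting a Kraus representation `E(X) = Σ_i K_i X K_i*`
with `Σ_i K_i* K_i = 1`. -/
def IsQChannel {ι κ : Type*} [Fintype ι] [DecidableEq ι] [Fintype κ] [DecidableEq κ]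
    (E : Matrix ι ι ℂ → Matrix κ κ ℂ) : Prop :=
  ∃ (k : ℕ) (K : Fin k → Matrix κ ι ℂ),
    (∀ X, E X = ∑ i, K i * X * (K i)ᴴ) ∧ (∑ i, (K i)ᴴ * K i = 1)

/-- The α-fidelity of channels:
`𝓕_α(E₁,E₂) = inf { F_α(E₁(ρ₁),E₂(ρ₂)) / F_α(ρ₁,ρ₂) }` over density matrices with
`F_α(ρ₁,ρ₂) > 0`. -/
noncomputable def chanFid {ι κ : Type*} [Fintype ι] [DecidableEq ι] [Fintype κ] [DecidableEq κ]
    (α : ℝ) (E₁ E₂ : Matrix ι ι ℂ → Matrix κ κ ℂ) : ℝ :=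
  sInf { r : ℝ | ∃ ρ₁ ρ₂ : Matrix ι ι ℂ, IsDensity ρ₁ ∧ IsDensity ρ₂ ∧
    0 < aFid α ρ₁ ρ₂ ∧ r = aFid α (E₁ ρ₁) (E₂ ρ₂) / aFid α ρ₁ ρ₂ }

section Powers

variable {ι : Type*} [Fintype ι] [DecidableEq ι] {A B : Matrix ι ι ℂ}

lemma mpow_eq_cfc (hA : A.IsHermitian) (t : ℝ) : mpow A t = cfc (fun x : ℝ => x ^ t) A := by
  rw [hA.cfc_eq, mpow, dif_pos hA, IsHermitian.cfc, Unitary.conjStarAlgAut_apply]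
  rfl

lemma continuousOn_spectrum (A : Matrix ι ι ℂ) (f : ℝ → ℝ) : ContinuousOn f (spectrum ℝ A) :=
  (Matrix.finite_real_spectrum (A := A)).continuousOn f

lemma mpow_isHermitian (hA : A.IsHermitian) (t : ℝ) : (mpow A t).IsHermitian := by
  rw [mpow_eq_cfc hA]
  exact cfc_predicate (p := IsSelfAdjoint) _ A

lemma mpow_posSemidef (hA : A.PosSemidef) (t : ℝ) : (mpow A t).PosSemidef := by
  rw [mpow, dif_pos hA.isHermitian, star_eq_conjTranspose]
  refine PosSemidef.mul_mul_conjTranspose_same (posSemidef_diagonal_iff.2 fun i => ?_) _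
  exact_mod_cast Real.rpow_nonneg (hA.eigenvalues_nonneg i) t

lemma mpow_add_of_posDef (hA : A.PosDef) (s t : ℝ) : mpow A s * mpow A t = mpow A (s + t) := by
  have hH := hA.isHermitian
  rw [mpow_eq_cfc hH, mpow_eq_cfc hH, mpow_eq_cfc hH, ← cfc_mul _ _ A
    (continuousOn_spectrum A _) (continuousOn_spectrum A _)]
  refine cfc_congr fun x hx => ?_
  obtain ⟨i, rfl⟩ := hH.spectrum_real_eq_range_eigenvalues ▸ hx
  exact (Real.rpow_add (hA.eigenvalues_pos i) s t).symm

lemma mpow_add_of_posSemidef (hA : A.PosSemidef) {s t : ℝ} (hs : 0 ≤ s) (ht : 0 ≤ t) :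
    mpow A s * mpow A t = mpow A (s + t) := by
  have hH := hA.isHermitian
  rw [mpow_eq_cfc hH, mpow_eq_cfc hH, mpow_eq_cfc hH, ← cfc_mul _ _ A
    (continuousOn_spectrum A _) (continuousOn_spectrum A _)]
  refine cfc_congr fun x hx => ?_
  obtain ⟨i, rfl⟩ := hH.spectrum_real_eq_range_eigenvalues ▸ hx
  exact (Real.rpow_add_of_nonneg (hA.eigenvalues_nonneg i) hs ht).symm

lemma mpow_mpow (hA : A.PosSemidef) (s t : ℝ) : mpow (mpow A s) t = mpow A (s * t) := by
  have hH := hA.isHermitian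
  rw [mpow_eq_cfc (mpow_isHermitian hH s), mpow_eq_cfc hH, mpow_eq_cfc hH,
    ← cfc_comp' (p := IsSelfAdjoint) (fun x : ℝ => x ^ t) (fun x : ℝ => x ^ s) A
      (((Matrix.finite_real_spectrum (A := A)).image _).continuousOn _)
      (continuousOn_spectrum A _) hH]
  refine cfc_congr fun x hx => ?_
  obtain ⟨i, rfl⟩ := hH.spectrum_real_eq_range_eigenvalues ▸ hx
  exact (Real.rpow_mul (hA.eigenvalues_nonneg i) s t).symm

lemma mpow_zero (hA : A.IsHermitian) : mpow A 0 = 1 := by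
  rw [mpow_eq_cfc hA]
  simpa using cfc_const_one ℝ A (p := IsSelfAdjoint) hA

lemma mpow_one (hA : A.IsHermitian) : mpow A 1 = A := by
  rw [mpow_eq_cfc hA]
  simpa using cfc_id' ℝ A (p := IsSelfAdjoint) hA

lemma mpow_neg_mul_mpow (hA : A.PosDef) (t : ℝ) : mpow A (-t) * mpow A t = 1 := by
  rw [mpow_add_of_posDef hA, neg_add_cancel, mpow_zero hA.isHermitian]

lemma mpow_mul_mpow_neg (hA : A.PosDef) (t : ℝ) : mpow A t * mpow A (-t) = 1 := by
  rw [mpow_add_of_posDef hA, add_neg_cancel, mpow_zero hA.isHermitian]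

lemma mpow_neg_one (hA : A.PosDef) : mpow A (-1) = A⁻¹ := by
  refine (Matrix.inv_eq_left_inv ?_).symm
  simpa [mpow_one hA.isHermitian] using mpow_neg_mul_mpow hA 1

lemma mpow_posDef (hA : A.PosDef) (t : ℝ) : (mpow A t).PosDef := by
  refine (mpow_posSemidef hA.posSemidef t).posDef_iff_isUnit.2 ?_
  exact IsUnit.of_mul_eq_one _ (mpow_mul_mpow_neg hA t)

lemma mpow_half_mul_self (hA : A.PosSemidef) (t : ℝ) (ht : 0 ≤ t) :
    mpow A (t / 2) * mpow A (t / 2) = mpow A t := by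
  rw [mpow_add_of_posSemidef hA (by positivity) (by positivity), add_halves]

lemma trace_mpow (hA : A.IsHermitian) (t : ℝ) :
    (mpow A t).trace = ((A.charpoly.roots.map fun z => ((z.re ^ t : ℝ) : ℂ)).sum) := by
  rw [mpow, dif_pos hA, Matrix.mul_assoc, Matrix.trace_mul_comm, Matrix.mul_assoc,
    Unitary.coe_star_mul_self, mul_one, hA.roots_charpoly_eq_eigenvalues, Matrix.trace_diagonal,
    Multiset.map_map]
  simp

lemma trace_mpow_mul_comm (h₁ : (A * B).IsHermitian) (h₂ : (B * A).IsHermitian) (t : ℝ) :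
    (mpow (A * B) t).trace = (mpow (B * A) t).trace := by
  rw [trace_mpow h₁, trace_mpow h₂, charpoly_mul_comm]

open scoped Matrix.Norms.L2Operator in
lemma tendsto_mpow {X : Type*} {l : Filter X} {f : X → Matrix ι ι ℂ} {t : ℝ} (ht : 0 ≤ t)
    (hf : ∀ x, (f x).IsHermitian) (hA : A.IsHermitian) (h : Filter.Tendsto f l (nhds A)) :
    Filter.Tendsto (fun x => mpow (f x) t) l (nhds (mpow A t)) := by
  have hc : ContinuousOn (fun a : Matrix ι ι ℂ => cfc (fun x : ℝ => x ^ t) a)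
      {a | IsSelfAdjoint a} :=
    ContinuousOn.cfc_of_mem_nhdsSet (s := Set.univ) (p := IsSelfAdjoint) _ (by simp)
      continuousOn_id (fun _ hx => hx) (Real.continuous_rpow_const ht).continuousOn
  have := (hc A hA).tendsto.comp (tendsto_nhdsWithin_iff.2 ⟨h, .of_forall hf⟩)
  rw [mpow_eq_cfc hA]
  refine this.congr fun x => ?_
  simp [mpow_eq_cfc (hf x)]

end Powers

section Interpolation

variable {ι κ : Type*} [Fintype ι] [DecidableEq ι] [Fintype κ] [DecidableEq κ]

lemma trace_mul_re_nonneg {P Q : Matrix ι ι ℂ} (hP : P.PosSemidef) (hQ : Q.PosSemidef) :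
    0 ≤ (P * Q).trace.re := by
  have hS := mpow_isHermitian hQ.isHermitian (1 / 2)
  have h : (P * Q).trace = ((mpow Q (1 / 2))ᴴ * P * mpow Q (1 / 2)).trace := by
    rw [hS.eq, Matrix.trace_mul_comm (mpow Q (1 / 2) * P), ← Matrix.mul_assoc,
      mpow_half_mul_self hQ 1 zero_le_one, mpow_one hQ.isHermitian, Matrix.trace_mul_comm]
  rw [h]
  exact (Complex.le_def.1 (hP.conjTranspose_mul_mul_same (mpow Q (1 / 2))).trace_nonneg).1

lemma trace_mul_re_mono_left {P P' Q : Matrix ι ι ℂ} (h : (P' - P).PosSemidef)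
    (hQ : Q.PosSemidef) : (P * Q).trace.re ≤ (P' * Q).trace.re := by
  have := trace_mul_re_nonneg h hQ
  rw [Matrix.sub_mul, Matrix.trace_sub, Complex.sub_re] at this
  linarith

lemma trace_conj_diagonal_re (U : Matrix ι ι ℂ) (W : Matrix κ κ ℂ) (a : ι → ℝ) (b : κ → ℝ)
    (T : Matrix ι κ ℂ) :
    (Tᴴ * (U * diagonal (fun i => (a i : ℂ)) * Uᴴ) * T *
      (W * diagonal (fun j => (b j : ℂ)) * Wᴴ)).trace.re =
      ∑ p : ι × κ, a p.1 * b p.2 * Complex.normSq ((Uᴴ * T * W) p.1 p.2) := by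
  set M := Uᴴ * T * W with hM
  have h : (Tᴴ * (U * diagonal (fun i => (a i : ℂ)) * Uᴴ) * T *
      (W * diagonal (fun j => (b j : ℂ)) * Wᴴ)).trace =
      (Mᴴ * (diagonal (fun i => (a i : ℂ)) * M * diagonal (fun j => (b j : ℂ)))).trace := by
    rw [← Matrix.mul_assoc _ _ Wᴴ, Matrix.trace_mul_comm]
    simp only [hM, conjTranspose_mul, conjTranspose_conjTranspose, Matrix.mul_assoc]
  rw [h, Matrix.trace, Complex.re_sum, Fintype.sum_prod_type, Finset.sum_comm]
  refine Finset.sum_congr rfl fun j _ => ?_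
  rw [Matrix.diag_apply, Matrix.mul_apply, Complex.re_sum]
  refine Finset.sum_congr rfl fun i _ => ?_
  rw [Matrix.mul_diagonal, Matrix.diagonal_mul, conjTranspose_apply, Complex.normSq_apply]
  simp
  ring

lemma mpow_eq_conj_diagonal {A : Matrix ι ι ℂ} (hA : A.IsHermitian) (t : ℝ) :
    mpow A t = (hA.eigenvectorUnitary : Matrix ι ι ℂ) *
      diagonal (fun i => ((hA.eigenvalues i ^ t : ℝ) : ℂ)) *
      (hA.eigenvectorUnitary : Matrix ι ι ℂ)ᴴ := by
  rw [mpow, dif_pos hA, star_eq_conjTranspose]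

/-- The quadratic forms `T ↦ tr (T* σ^s T ω^(-s))` are simultaneously diagonalizable. -/
lemma exists_diagonalization {σ ω : Matrix ι ι ℂ} (hσ : σ.PosSemidef) (hω : ω.PosDef) :
    ∃ (L : Matrix ι ι ℂ ≃+ Matrix ι ι ℂ) (c : ι × ι → ℝ), (∀ p, 0 ≤ c p) ∧
      ∀ (s : ℝ) (T : Matrix ι ι ℂ), (Tᴴ * mpow σ s * T * mpow ω (-s)).trace.re =
        ∑ p : ι × ι, c p ^ s * Complex.normSq (L T p.1 p.2) := by
  have hσH := hσ.isHermitian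
  have hωH := hω.isHermitian
  set U : Matrix ι ι ℂ := (hσH.eigenvectorUnitary : Matrix ι ι ℂ) with hU
  set W : Matrix ι ι ℂ := (hωH.eigenvectorUnitary : Matrix ι ι ℂ) with hW
  have hU1 : Uᴴ * U = 1 := Unitary.coe_star_mul_self hσH.eigenvectorUnitary
  have hU2 : U * Uᴴ = 1 := Unitary.coe_mul_star_self hσH.eigenvectorUnitary
  have hW1 : Wᴴ * W = 1 := Unitary.coe_star_mul_self hωH.eigenvectorUnitary
  have hW2 : W * Wᴴ = 1 := Unitary.coe_mul_star_self hωH.eigenvectorUnitary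
  let L : Matrix ι ι ℂ ≃+ Matrix ι ι ℂ :=
    { toFun := fun T => Uᴴ * T * W
      invFun := fun T => U * T * Wᴴ
      left_inv := fun T => by
        simp only [Matrix.mul_assoc, hW2, Matrix.mul_one]
        rw [← Matrix.mul_assoc, hU2, Matrix.one_mul]
      right_inv := fun T => by
        simp only [Matrix.mul_assoc, hW1, Matrix.mul_one]
        rw [← Matrix.mul_assoc, hU1, Matrix.one_mul]
      map_add' := fun S T => by rw [Matrix.mul_add, Matrix.add_mul] }
  refine ⟨L, fun p => hσH.eigenvalues p.1 * (hωH.eigenvalues p.2)⁻¹, fun p => ?_, fun s T => ?_⟩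
  · exact mul_nonneg (hσ.eigenvalues_nonneg _) (inv_nonneg.2 (hω.eigenvalues_pos _).le)
  · rw [mpow_eq_conj_diagonal hσH, mpow_eq_conj_diagonal hωH, trace_conj_diagonal_re]
    refine Finset.sum_congr rfl fun p _ => ?_
    rw [Real.mul_rpow (hσ.eigenvalues_nonneg _) (inv_nonneg.2 (hω.eigenvalues_pos _).le),
      Real.inv_rpow (hω.eigenvalues_pos _).le, Real.rpow_neg (hω.eigenvalues_pos _).le]
    rfl

lemma parallel_sum_le {l t : ℝ} (hl : 0 ≤ l) (ht : 0 < t) (x y : ℂ) :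
    t * l / (t + l) * Complex.normSq (x + y) ≤ l * Complex.normSq x + t * Complex.normSq y := by
  rw [div_mul_eq_mul_div, div_le_iff₀ (by positivity)]
  simp only [Complex.normSq_apply, Complex.add_re, Complex.add_im]
  nlinarith [sq_nonneg (l * x.re - t * y.re), sq_nonneg (l * x.im - t * y.im)]

lemma parallel_sum_eq {l t : ℝ} (hl : 0 ≤ l) (ht : 0 < t) (z : ℂ) :
    l * Complex.normSq ((t / (t + l) : ℝ) * z) + t * Complex.normSq (z - (t / (t + l) : ℝ) * z) =
      t * l / (t + l) * Complex.normSq z := by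
  have h : z - (t / (t + l) : ℝ) * z = (l / (t + l) : ℝ) * z := by
    have : (t : ℂ) + l ≠ 0 := by exact_mod_cast (by positivity : t + l ≠ 0)
    push_cast
    field_simp
    ring
  rw [h, Complex.normSq_mul, Complex.normSq_mul, Complex.normSq_ofReal, Complex.normSq_ofReal]
  have : t + l ≠ 0 := by positivity
  field_simp

open MeasureTheory in
lemma integral_sum_rpowIntegrand {I : Type*} [Fintype I] {c : I → ℝ} (hc : ∀ i, 0 ≤ c i)
    (x : I → ℝ) {s : ℝ} (hs : s ∈ Set.Ioo 0 1) :
    IntegrableOn (fun t => ∑ i, Real.rpowIntegrand₀₁ s t (c i) * x i) (Set.Ioi 0) ∧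
      ∫ t in Set.Ioi 0, ∑ i, Real.rpowIntegrand₀₁ s t (c i) * x i =
        (∫ t in Set.Ioi 0, Real.rpowIntegrand₀₁ s t 1) * ∑ i, c i ^ s * x i := by
  have hi : ∀ i ∈ Finset.univ, IntegrableOn (fun t => Real.rpowIntegrand₀₁ s t (c i) * x i)
      (Set.Ioi 0) := fun i _ =>
    (Real.integrableOn_rpowIntegrand₀₁_Ioi hs (hc i)).mul_const _
  refine ⟨integrable_finsetSum _ hi, ?_⟩
  rw [integral_finsetSum _ hi, Finset.mul_sum]
  refine Finset.sum_congr rfl fun i _ => ?_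
  rw [integral_mul_const, Real.integral_rpowIntegrand₀₁_eq_rpow_mul_const hs (hc i)]
  ring

open MeasureTheory in
lemma sum_rpow_mul_le_of_resolvent {I J : Type*} [Fintype I] [Fintype J] {c x : I → ℝ}
    {d y : J → ℝ} (hc : ∀ i, 0 ≤ c i) (hd : ∀ j, 0 ≤ d j)
    (h : ∀ t : ℝ, 0 < t → ∑ i, t * c i / (t + c i) * x i ≤ ∑ j, t * d j / (t + d j) * y j)
    {s : ℝ} (hs : s ∈ Set.Ioo 0 1) : ∑ i, c i ^ s * x i ≤ ∑ j, d j ^ s * y j := by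
  obtain ⟨hi₁, he₁⟩ := integral_sum_rpowIntegrand hc x hs
  obtain ⟨hi₂, he₂⟩ := integral_sum_rpowIntegrand hd y hs
  refine le_of_mul_le_mul_left ?_ (Real.integral_rpowIntegrand₀₁_one_pos hs)
  rw [← he₁, ← he₂]
  refine setIntegral_mono_on hi₁ hi₂ measurableSet_Ioi fun t ht => ?_
  rw [Set.mem_Ioi] at ht
  have hr : ∀ l : ℝ, 0 ≤ l →
      Real.rpowIntegrand₀₁ s t l = t ^ (s - 1) * t⁻¹ * (t * l / (t + l)) := fun l hl => by
    rw [Real.rpowIntegrand₀₁_eq_pow_div hs ht.le hl]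
    field_simp
  simp only [hr _ (hc _), hr _ (hd _), mul_assoc, ← Finset.mul_sum]
  gcongr
  exact h t ht

/-- Quadratic interpolation: an additive map contracting the Hilbert–Schmidt norm and the
forms `tr (T* σ T ω⁻¹)` contracts all the intermediate forms `tr (T* σ^s T ω^(-s))`. -/
lemma trace_mpow_interpolation {σ ω : Matrix ι ι ℂ} {τ η : Matrix κ κ ℂ} (hσ : σ.PosSemidef)
    (hω : ω.PosDef) (hτ : τ.PosSemidef) (hη : η.PosDef) (V : Matrix κ κ ℂ → Matrix ι ι ℂ)
    (hadd : ∀ X Y, V (X + Y) = V X + V Y)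
    (h₀ : ∀ Y, ((V Y)ᴴ * V Y).trace.re ≤ (Yᴴ * Y).trace.re)
    (h₁ : ∀ Y, ((V Y)ᴴ * σ * V Y * ω⁻¹).trace.re ≤ (Yᴴ * τ * Y * η⁻¹).trace.re)
    {s : ℝ} (hs : 0 < s) (hs' : s ≤ 1) (Y : Matrix κ κ ℂ) :
    ((V Y)ᴴ * mpow σ s * V Y * mpow ω (-s)).trace.re ≤
      (Yᴴ * mpow τ s * Y * mpow η (-s)).trace.re := by
  obtain rfl | hs' := hs'.eq_or_lt
  · simpa only [mpow_one hσ.isHermitian, mpow_one hτ.isHermitian, mpow_neg_one hω,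
      mpow_neg_one hη] using h₁ Y
  obtain ⟨L, c, hc, hL⟩ := exists_diagonalization hσ hω
  obtain ⟨M, d, hd, hM⟩ := exists_diagonalization hτ hη
  rw [hL, hM]
  refine sum_rpow_mul_le_of_resolvent hc hd (fun t ht => ?_) ⟨hs, hs'⟩
  set a : Matrix κ κ ℂ := M.symm (Matrix.of fun i j => (t / (t + d (i, j)) : ℝ) * M Y i j) with ha
  have hMa : ∀ p : κ × κ, M a p.1 p.2 = (t / (t + d p) : ℝ) * M Y p.1 p.2 := fun p => by
    simp [ha]
  have hMb : ∀ p : κ × κ, M (Y - a) p.1 p.2 = M Y p.1 p.2 - (t / (t + d p) : ℝ) * M Y p.1 p.2 :=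
    fun p => by rw [map_sub, Matrix.sub_apply, hMa]
  have hV : L (V Y) = L (V a) + L (V (Y - a)) := by
    rw [← map_add, ← hadd, add_sub_cancel]
  have e₀ : ∀ T, (Tᴴ * T).trace.re = ∑ p : ι × ι, Complex.normSq (L T p.1 p.2) := fun T => by
    simpa [mpow_zero hσ.isHermitian, mpow_zero hω.isHermitian] using hL 0 T
  have e₁ : ∀ T, (Tᴴ * σ * T * ω⁻¹).trace.re =
      ∑ p : ι × ι, c p * Complex.normSq (L T p.1 p.2) := fun T => by
    simpa [mpow_one hσ.isHermitian, mpow_neg_one hω] using hL 1 T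
  have f₀ : ∀ T, (Tᴴ * T).trace.re = ∑ p : κ × κ, Complex.normSq (M T p.1 p.2) := fun T => by
    simpa [mpow_zero hτ.isHermitian, mpow_zero hη.isHermitian] using hM 0 T
  have f₁ : ∀ T, (Tᴴ * τ * T * η⁻¹).trace.re =
      ∑ p : κ × κ, d p * Complex.normSq (M T p.1 p.2) := fun T => by
    simpa [mpow_one hτ.isHermitian, mpow_neg_one hη] using hM 1 T
  calc ∑ p : ι × ι, t * c p / (t + c p) * Complex.normSq (L (V Y) p.1 p.2)
      ≤ ∑ p : ι × ι, (c p * Complex.normSq (L (V a) p.1 p.2) +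
          t * Complex.normSq (L (V (Y - a)) p.1 p.2)) := by
        refine Finset.sum_le_sum fun p _ => ?_
        rw [hV, Matrix.add_apply]
        exact parallel_sum_le (hc p) ht _ _
    _ = ((V a)ᴴ * σ * V a * ω⁻¹).trace.re + t * ((V (Y - a))ᴴ * V (Y - a)).trace.re := by
        rw [Finset.sum_add_distrib, ← Finset.mul_sum, e₀, e₁]
    _ ≤ (aᴴ * τ * a * η⁻¹).trace.re + t * ((Y - a)ᴴ * (Y - a)).trace.re := by
        have := h₀ (Y - a)
        have := h₁ a
        gcongr
    _ = ∑ p : κ × κ, t * d p / (t + d p) * Complex.normSq (M Y p.1 p.2) := by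
        rw [f₀, f₁, Finset.mul_sum, ← Finset.sum_add_distrib]
        refine Finset.sum_congr rfl fun p _ => ?_
        rw [hMa, hMb]
        exact parallel_sum_eq (hd p) ht _

end Interpolation

section Kraus

variable {ι κ : Type*} [Fintype κ] {k : ℕ}

/-- The adjoint of the completely positive map with Kraus operators `K`. -/
def krausAdjoint (K : Fin k → Matrix κ ι ℂ) (X : Matrix κ κ ℂ) : Matrix ι ι ℂ :=
  ∑ i, (K i)ᴴ * X * K i

lemma krausAdjoint_add (K : Fin k → Matrix κ ι ℂ) (X Y : Matrix κ κ ℂ) :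
    krausAdjoint K (X + Y) = krausAdjoint K X + krausAdjoint K Y := by
  simp [krausAdjoint, Matrix.mul_add, Matrix.add_mul, Finset.sum_add_distrib]

lemma krausAdjoint_conjTranspose (K : Fin k → Matrix κ ι ℂ) (X : Matrix κ κ ℂ) :
    krausAdjoint K Xᴴ = (krausAdjoint K X)ᴴ := by
  simp [krausAdjoint, conjTranspose_sum, Matrix.mul_assoc]

lemma krausAdjoint_one [DecidableEq ι] [DecidableEq κ] {K : Fin k → Matrix κ ι ℂ}
    (hK : ∑ i, (K i)ᴴ * K i = 1) : krausAdjoint K 1 = 1 := by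
  simpa [krausAdjoint] using hK

variable [Fintype ι]

/-- The completely positive map with Kraus operators `K`. -/
def krausMap (K : Fin k → Matrix κ ι ℂ) (X : Matrix ι ι ℂ) : Matrix κ κ ℂ :=
  ∑ i, K i * X * (K i)ᴴ

lemma trace_krausAdjoint_mul (K : Fin k → Matrix κ ι ℂ) (X : Matrix κ κ ℂ) (ρ : Matrix ι ι ℂ) :
    (krausAdjoint K X * ρ).trace = (X * krausMap K ρ).trace := by
  simp only [krausAdjoint, krausMap, Matrix.sum_mul, Matrix.mul_sum, Matrix.trace_sum]
  refine Finset.sum_congr rfl fun i _ => ?_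
  rw [Matrix.mul_assoc, Matrix.mul_assoc, Matrix.trace_mul_comm]
  simp only [Matrix.mul_assoc]

lemma krausMap_add_smul {μ : Type*} (K : Fin k → Matrix μ ι ℂ) (X Y : Matrix ι ι ℂ) (c : ℂ) :
    krausMap K (X + c • Y) = krausMap K X + c • krausMap K Y := by
  simp [krausMap, Matrix.mul_add, Matrix.add_mul, Finset.sum_add_distrib, Finset.smul_sum]

lemma krausMap_posSemidef (K : Fin k → Matrix κ ι ℂ) {ρ : Matrix ι ι ℂ} (hρ : ρ.PosSemidef) :
    (krausMap K ρ).PosSemidef :=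
  posSemidef_sum _ fun i _ => hρ.mul_mul_conjTranspose_same (K i)

lemma krausAdjoint_posSemidef (K : Fin k → Matrix κ ι ℂ) {X : Matrix κ κ ℂ} (hX : X.PosSemidef) :
    (krausAdjoint K X).PosSemidef :=
  posSemidef_sum _ fun i _ => hX.conjTranspose_mul_mul_same (K i)

lemma krausAdjoint_posDef [DecidableEq ι] [DecidableEq κ] {K : Fin k → Matrix κ ι ℂ}
    (hK : ∑ i, (K i)ᴴ * K i = 1) {G : Matrix κ κ ℂ} (hG : G.PosDef) :
    (krausAdjoint K G).PosDef := by
  refine PosDef.of_dotProduct_mulVec_pos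
    (krausAdjoint_posSemidef K hG.posSemidef).isHermitian fun x hx => ?_
  have he : star x ⬝ᵥ krausAdjoint K G *ᵥ x = ∑ i, star (K i *ᵥ x) ⬝ᵥ G *ᵥ (K i *ᵥ x) := by
    simp only [krausAdjoint, Matrix.sum_mulVec, dotProduct_sum, star_mulVec,
      ← Matrix.mulVec_mulVec, dotProduct_mulVec, Matrix.vecMul_vecMul]
  rw [he]
  obtain ⟨i, hi⟩ : ∃ i, K i *ᵥ x ≠ 0 := by
    by_contra! h
    refine hx ?_
    rw [← Matrix.one_mulVec x, ← hK, Matrix.sum_mulVec]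
    simp [← Matrix.mulVec_mulVec, h]
  exact Finset.sum_pos' (fun j _ => hG.posSemidef.dotProduct_mulVec_nonneg _)
    ⟨i, Finset.mem_univ i, hG.dotProduct_mulVec_pos hi⟩

/-- Operator Schwarz inequality of Lieb and Ruskai. -/
lemma krausAdjoint_schwarz [DecidableEq ι] [DecidableEq κ] {K : Fin k → Matrix κ ι ℂ}
    (hK : ∑ i, (K i)ᴴ * K i = 1) {G : Matrix κ κ ℂ} (hG : G.PosDef)
    (C : Matrix κ κ ℂ) : (krausAdjoint K (C * G⁻¹ * Cᴴ) -
      krausAdjoint K C * (krausAdjoint K G)⁻¹ * (krausAdjoint K C)ᴴ).PosSemidef := by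
  have hΦ := krausAdjoint_posDef hK hG
  set D := (krausAdjoint K G)⁻¹ * (krausAdjoint K C)ᴴ with hD
  have hGu : IsUnit G.det := (Matrix.isUnit_iff_isUnit_det _).1 hG.isUnit
  have hΦu : IsUnit (krausAdjoint K G).det := (Matrix.isUnit_iff_isUnit_det _).1 hΦ.isUnit
  have hGD : krausAdjoint K G * D = (krausAdjoint K C)ᴴ := by
    rw [hD, Matrix.mul_nonsing_inv_cancel_left _ _ hΦu]
  have h : krausAdjoint K (C * G⁻¹ * Cᴴ) -
      krausAdjoint K C * (krausAdjoint K G)⁻¹ * (krausAdjoint K C)ᴴ =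
      ∑ i, (Cᴴ * K i - G * K i * D)ᴴ * G⁻¹ * (Cᴴ * K i - G * K i * D) := by
    have ht : ∀ i, (Cᴴ * K i - G * K i * D)ᴴ * G⁻¹ * (Cᴴ * K i - G * K i * D) =
        (K i)ᴴ * (C * G⁻¹ * Cᴴ) * K i - (K i)ᴴ * C * K i * D -
          Dᴴ * ((K i)ᴴ * Cᴴ * K i) + Dᴴ * ((K i)ᴴ * G * K i * D) := fun i => by
      simp only [conjTranspose_sub, conjTranspose_mul, conjTranspose_conjTranspose,
        hG.isHermitian.eq, Matrix.sub_mul, Matrix.mul_sub, Matrix.mul_assoc,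
        Matrix.nonsing_inv_mul_cancel_left _ _ hGu, Matrix.mul_nonsing_inv_cancel_left _ _ hGu]
      abel
    simp only [ht, Finset.sum_add_distrib, Finset.sum_sub_distrib, ← Matrix.mul_sum,
      ← Matrix.sum_mul]
    change _ = krausAdjoint K (C * G⁻¹ * Cᴴ) - krausAdjoint K C * D - Dᴴ * krausAdjoint K Cᴴ +
      Dᴴ * (krausAdjoint K G * D)
    rw [hGD, krausAdjoint_conjTranspose, hD,
      ← Matrix.mul_assoc (krausAdjoint K C)]
    abel
  rw [h]
  exact posSemidef_sum _ fun i _ => hG.inv.posSemidef.conjTranspose_mul_mul_same _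

end Kraus

section DataProcessing

variable {ι κ : Type*} [Fintype ι] [DecidableEq ι] [Fintype κ] [DecidableEq κ]

lemma trace_mpow_mul_mpow_re {A B : Matrix ι ι ℂ} (hA : A.IsHermitian) (hB : B.IsHermitian)
    (s t : ℝ) : (mpow A s * mpow B t).trace.re =
      ∑ p : ι × ι, hA.eigenvalues p.1 ^ s * hB.eigenvalues p.2 ^ t *
        Complex.normSq (((hA.eigenvectorUnitary : Matrix ι ι ℂ)ᴴ *
          (hB.eigenvectorUnitary : Matrix ι ι ℂ)) p.1 p.2) := by
  have := trace_conj_diagonal_re (hA.eigenvectorUnitary : Matrix ι ι ℂ)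
    (hB.eigenvectorUnitary : Matrix ι ι ℂ) (fun i => hA.eigenvalues i ^ s)
    (fun i => hB.eigenvalues i ^ t) 1
  rwa [← mpow_eq_conj_diagonal, ← mpow_eq_conj_diagonal, conjTranspose_one, Matrix.one_mul,
    Matrix.mul_one, Matrix.mul_one] at this

lemma rpow_le_young {α x w : ℝ} (hα : 0 < α) (hα' : α < 1) (hx : 0 ≤ x) (hw : 0 < w) :
    x ^ α ≤ α * (x * w ^ (-((1 - α) / α))) + (1 - α) * w := by
  have h := Real.geom_mean_le_arith_mean2_weighted hα.le (sub_nonneg.2 hα'.le)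
    (mul_nonneg hx (Real.rpow_nonneg hw.le (-((1 - α) / α)))) hw.le (by ring)
  refine le_of_eq_of_le ?_ h
  rw [Real.mul_rpow hx (Real.rpow_nonneg hw.le _), ← Real.rpow_mul hw.le, mul_assoc,
    ← Real.rpow_add hw]
  have : -((1 - α) / α) * α + (1 - α) = 0 := by field_simp; ring
  rw [this, Real.rpow_zero, mul_one]

/-- A reverse Young inequality for the trace of `A ^ α`. -/
lemma trace_mpow_le {α : ℝ} (hα : 0 < α) (hα' : α < 1) {A ω : Matrix ι ι ℂ} (hA : A.PosSemidef)
    (hω : ω.PosDef) : (mpow A α).trace.re ≤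
      α * (A * mpow ω (-((1 - α) / α))).trace.re + (1 - α) * ω.trace.re := by
  have hAH := hA.isHermitian
  have hωH := hω.isHermitian
  have h₁ : (mpow A α).trace.re = (mpow A α * mpow ω 0).trace.re := by
    rw [mpow_zero hωH, Matrix.mul_one]
  have h₂ : (A * mpow ω (-((1 - α) / α))).trace.re =
      (mpow A 1 * mpow ω (-((1 - α) / α))).trace.re := by rw [mpow_one hAH]
  have h₃ : ω.trace.re = (mpow A 0 * mpow ω 1).trace.re := by
    rw [mpow_one hωH, mpow_zero hAH, Matrix.one_mul]
  rw [h₁, h₂, h₃]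
  simp only [trace_mpow_mul_mpow_re hAH hωH, Finset.mul_sum, ← Finset.sum_add_distrib]
  refine Finset.sum_le_sum fun p _ => ?_
  have := mul_le_mul_of_nonneg_right
    (rpow_le_young hα hα' (hA.eigenvalues_nonneg p.1) (hω.eigenvalues_pos p.2))
    (Complex.normSq_nonneg (((hAH.eigenvectorUnitary : Matrix ι ι ℂ)ᴴ *
          (hωH.eigenvectorUnitary : Matrix ι ι ℂ)) p.1 p.2))
  simp only [Real.rpow_zero, Real.rpow_one, mul_one, one_mul]
  linarith

lemma mul_mul_posSemidef {ν : Type*} [Fintype ν] {A S : Matrix ν ν ℂ} (hA : A.PosSemidef)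
    (hS : S.IsHermitian) : (S * A * S).PosSemidef := by
  simpa only [hS.eq] using hA.mul_mul_conjTranspose_same S

lemma mul_mul_posDef {A S : Matrix ι ι ℂ} (hA : A.PosDef) (hS : S.PosDef) :
    (S * A * S).PosDef := by
  refine (mul_mul_posSemidef hA.posSemidef hS.isHermitian).posDef_iff_isUnit.2 ?_
  exact (hS.isUnit.mul hA.isUnit).mul hS.isUnit

lemma aFid_eq {α : ℝ} (hα : 0 < α) (hα' : α < 1) {ρ σ : Matrix ι ι ℂ} (hρ : ρ.PosSemidef)
    (hσ : σ.PosSemidef) : aFid α ρ σ =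
      (mpow (mpow ρ (1 / 2) * mpow σ ((1 - α) / α) * mpow ρ (1 / 2)) α).trace.re := by
  have hs : 0 ≤ (1 - α) / α := div_nonneg (by linarith) hα.le
  have hρ2 := mpow_half_mul_self hρ 1 zero_le_one
  rw [mpow_one hρ.isHermitian] at hρ2
  have hσ2 := mpow_half_mul_self hσ _ hs
  have hR := mpow_isHermitian hρ.isHermitian (1 / 2)
  have hS := mpow_isHermitian hσ.isHermitian ((1 - α) / α / 2)
  have h₁ := (mul_mul_posSemidef hρ hS).isHermitian
  have h₂ := (mul_mul_posSemidef (mpow_posSemidef hσ ((1 - α) / α)) hR).isHermitian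
  have he : (1 - α) / (2 * α) = (1 - α) / α / 2 := by field_simp
  have e₁ : mpow σ ((1 - α) / α / 2) * ρ * mpow σ ((1 - α) / α / 2) =
      mpow σ ((1 - α) / α / 2) * mpow ρ (1 / 2) *
        (mpow ρ (1 / 2) * mpow σ ((1 - α) / α / 2)) := by
    rw [← Matrix.mul_assoc, Matrix.mul_assoc _ (mpow ρ (1 / 2)) (mpow ρ (1 / 2)), hρ2]
  have e₂ : mpow ρ (1 / 2) * mpow σ ((1 - α) / α) * mpow ρ (1 / 2) =
      mpow ρ (1 / 2) * mpow σ ((1 - α) / α / 2) *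
        (mpow σ ((1 - α) / α / 2) * mpow ρ (1 / 2)) := by
    rw [← Matrix.mul_assoc, Matrix.mul_assoc _ (mpow σ _) (mpow σ _), hσ2]
  rw [e₁] at h₁
  rw [e₂] at h₂
  rw [aFid, he, e₁, e₂, trace_mpow_mul_comm h₁ h₂]

lemma aFid_le_of_posDef {α : ℝ} (hα : 1 / 2 ≤ α) (hα' : α < 1) {k : ℕ}
    {K : Fin k → Matrix κ ι ℂ} (hK : ∑ i, (K i)ᴴ * K i = 1) {ρ σ : Matrix ι ι ℂ}
    {r τ : Matrix κ κ ℂ} (hρ : ρ.PosDef) (hσ : σ.PosSemidef) (hr : r.PosDef) (hτ : τ.PosDef)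
    (hrρ : (r - krausMap K ρ).PosSemidef) (hτσ : (τ - krausMap K σ).PosSemidef) :
    aFid α ρ σ ≤ aFid α r τ := by
  have hα0 : 0 < α := by linarith
  set s := (1 - α) / α with hs
  have hs0 : 0 < s := div_pos (by linarith) hα0
  have hs1 : s ≤ 1 := (div_le_one hα0).2 (by linarith)
  set R := mpow ρ (1 / 2) with hR
  set S := mpow r (1 / 2) with hS
  set N := mpow r (-(1 / 2)) with hN
  have hRd : R.PosDef := mpow_posDef hρ _
  have hSd : S.PosDef := mpow_posDef hr _
  have hNd : N.PosDef := mpow_posDef hr _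
  have hRR : R * R = ρ := by
    rw [hR, mpow_half_mul_self hρ.posSemidef 1 zero_le_one, mpow_one hρ.isHermitian]
  have hSS : S * S = r := by
    rw [hS, mpow_half_mul_self hr.posSemidef 1 zero_le_one, mpow_one hr.isHermitian]
  have hSN : S * N = 1 := mpow_mul_mpow_neg hr _
  have hNS : N * S = 1 := mpow_neg_mul_mpow hr _
  have hNi : N⁻¹ = S := Matrix.inv_eq_left_inv hSN
  have hNrN : N * r * N = 1 := by
    rw [← hSS, ← Matrix.mul_assoc, hNS, Matrix.one_mul, hSN]
  have hRu : IsUnit R.det := (Matrix.isUnit_iff_isUnit_det _).1 hRd.isUnit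
  set B := S * mpow τ s * S with hB
  have hBd : B.PosDef := mul_mul_posDef (mpow_posDef hτ s) hSd
  set η := mpow B α with hη
  have hηd : η.PosDef := mpow_posDef hBd α
  set G := N * η * N with hG
  have hGd : G.PosDef := mul_mul_posDef hηd hNd
  have hGi : G⁻¹ = S * η⁻¹ * S := by
    rw [hG, Matrix.mul_inv_rev, Matrix.mul_inv_rev, hNi, Matrix.mul_assoc]
  have hΦG := krausAdjoint_posDef hK hGd
  set ω := R * krausAdjoint K G * R with hω
  have hωd : ω.PosDef := mul_mul_posDef hΦG hRd
  have hωi : R * ω⁻¹ * R = (krausAdjoint K G)⁻¹ := by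
    rw [hω, Matrix.mul_inv_rev, Matrix.mul_inv_rev, ← Matrix.mul_assoc,
      Matrix.mul_nonsing_inv _ hRu, Matrix.one_mul, Matrix.mul_assoc,
      Matrix.nonsing_inv_mul _ hRu, Matrix.mul_one]
  have htrω : ω.trace.re ≤ η.trace.re := by
    have h₁ : ω.trace = (krausMap K ρ * G).trace := by
      rw [hω, Matrix.mul_assoc, Matrix.trace_mul_comm, Matrix.mul_assoc, hRR,
        trace_krausAdjoint_mul, Matrix.trace_mul_comm]
    have h₂ : η.trace = (r * G).trace := by
      rw [hG, ← Matrix.mul_assoc, Matrix.trace_mul_comm, ← Matrix.mul_assoc, ← Matrix.mul_assoc,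
        hNrN, Matrix.one_mul]
    rw [h₁, h₂]
    exact trace_mul_re_mono_left hrρ hGd.posSemidef
  have hint := trace_mpow_interpolation hσ hωd hτ.posSemidef hηd
    (fun Y => krausAdjoint K (Y * N) * R)
    (fun X Y => by rw [Matrix.add_mul, krausAdjoint_add, Matrix.add_mul])
    (fun Y => by
      have h₁ : ((krausAdjoint K (Y * N) * R)ᴴ * (krausAdjoint K (Y * N) * R)).trace =
          ((krausAdjoint K (Y * N))ᴴ * krausAdjoint K (Y * N) * ρ).trace := by
        rw [conjTranspose_mul, hRd.isHermitian.eq, ← hRR, Matrix.mul_assoc,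
          Matrix.trace_mul_comm]
        simp only [Matrix.mul_assoc]
      have h₂ : (Yᴴ * Y).trace = (r * ((Y * N)ᴴ * (Y * N))).trace := by
        rw [conjTranspose_mul, hNd.isHermitian.eq, Matrix.trace_mul_comm r]
        rw [Matrix.mul_assoc N, Matrix.mul_assoc N, Matrix.trace_mul_comm N]
        simp only [Matrix.mul_assoc]
        rw [← Matrix.mul_assoc N r N, hNrN, Matrix.mul_one]
      have h₃ := krausAdjoint_schwarz hK (PosDef.one (n := κ) (R := ℂ)) (Y * N)ᴴ
      simp only [inv_one, Matrix.mul_one, krausAdjoint_one hK, conjTranspose_conjTranspose,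
        krausAdjoint_conjTranspose] at h₃
      have h₄ := trace_mul_re_mono_left h₃ hρ.posSemidef
      rw [h₁, h₂]
      refine h₄.trans ?_
      rw [trace_krausAdjoint_mul, Matrix.trace_mul_comm]
      exact trace_mul_re_mono_left hrρ (posSemidef_conjTranspose_mul_self _))
    (fun Y => by
      have h₁ : ((krausAdjoint K (Y * N) * R)ᴴ * σ * (krausAdjoint K (Y * N) * R) * ω⁻¹).trace =
          (krausAdjoint K (Y * N) * (krausAdjoint K G)⁻¹ * (krausAdjoint K (Y * N))ᴴ *
            σ).trace := by
        rw [conjTranspose_mul, hRd.isHermitian.eq, ← hωi, Matrix.mul_assoc R, Matrix.mul_assoc R,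
          Matrix.mul_assoc R, Matrix.trace_mul_comm R]
        simp only [Matrix.mul_assoc]
        rw [← Matrix.mul_assoc (krausAdjoint K (Y * N))ᴴ, Matrix.trace_mul_comm]
        simp only [Matrix.mul_assoc]
      have h₂ : Y * N * G⁻¹ * (Y * N)ᴴ = Y * η⁻¹ * Yᴴ := by
        rw [hGi, conjTranspose_mul, hNd.isHermitian.eq]
        simp only [Matrix.mul_assoc]
        rw [← Matrix.mul_assoc N S, hNS, Matrix.one_mul, ← Matrix.mul_assoc S N, hSN,
          Matrix.one_mul]
      have h₃ := krausAdjoint_schwarz hK hGd (Y * N)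
      rw [h₂] at h₃
      have h₄ := trace_mul_re_mono_left h₃ hσ
      have h₅ : (Yᴴ * τ * Y * η⁻¹).trace = (τ * (Y * η⁻¹ * Yᴴ)).trace := by
        rw [Matrix.mul_assoc, Matrix.mul_assoc, Matrix.trace_mul_comm]
        simp only [Matrix.mul_assoc]
      rw [h₁, h₅]
      refine h₄.trans ?_
      rw [trace_krausAdjoint_mul, Matrix.trace_mul_comm]
      exact trace_mul_re_mono_left hτσ (hηd.inv.posSemidef.mul_mul_conjTranspose_same Y))
    hs0 hs1 S
  simp only [hSN, krausAdjoint_one hK, Matrix.one_mul, hRd.isHermitian.eq,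
    hSd.isHermitian.eq] at hint
  have hval : (B * mpow η (-s)).trace = η.trace := by
    have hαs : 1 + α * -s = α := by rw [hs]; field_simp; ring
    rw [hη, mpow_mpow hBd.posSemidef]
    nth_rewrite 1 [← mpow_one hBd.isHermitian]
    rw [mpow_add_of_posDef hBd, hαs]
  rw [aFid_eq hα0 hα' hρ.posSemidef hσ, aFid_eq hα0 hα' hr.posSemidef hτ.posSemidef]
  calc (mpow (R * mpow σ s * R) α).trace.re
      ≤ α * (R * mpow σ s * R * mpow ω (-s)).trace.re + (1 - α) * ω.trace.re :=
        trace_mpow_le hα0 hα' (mul_mul_posSemidef (mpow_posSemidef hσ s) hRd.isHermitian) hωd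
    _ ≤ α * (B * mpow η (-s)).trace.re + (1 - α) * η.trace.re := by
        have : 0 ≤ 1 - α := by linarith
        gcongr
    _ = η.trace.re := by rw [hval]; ring

lemma tendsto_aFid {X : Type*} {l : Filter X} {α : ℝ} (hα : 0 < α) (hα' : α < 1)
    {f g : X → Matrix ι ι ℂ} {ρ σ : Matrix ι ι ℂ} (hf : ∀ x, (f x).PosSemidef)
    (hg : ∀ x, (g x).PosSemidef) (hρ : ρ.PosSemidef) (hσ : σ.PosSemidef)
    (hfl : Filter.Tendsto f l (nhds ρ)) (hgl : Filter.Tendsto g l (nhds σ)) :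
    Filter.Tendsto (fun x => aFid α (f x) (g x)) l (nhds (aFid α ρ σ)) := by
  have ht : 0 ≤ (1 - α) / (2 * α) := div_nonneg (by linarith) (by linarith)
  have h₁ := tendsto_mpow ht (fun x => (hg x).isHermitian) hσ.isHermitian hgl
  have hM : Continuous fun p : Matrix ι ι ℂ × Matrix ι ι ℂ => p.1 * p.2 * p.1 := by fun_prop
  have h₂ := (hM.tendsto _).comp (h₁.prodMk_nhds hfl)
  have h₃ := tendsto_mpow hα.le
    (fun x => (mul_mul_posSemidef (hf x) (mpow_isHermitian (hg x).isHermitian _)).isHermitian)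
    (mul_mul_posSemidef hρ (mpow_isHermitian hσ.isHermitian _)).isHermitian h₂
  have hT : Continuous fun M : Matrix ι ι ℂ => M.trace.re :=
    Complex.continuous_re.comp continuous_id.matrix_trace
  exact (hT.tendsto _).comp h₃

lemma tendsto_add_smul {ν : Type*} (A B : Matrix ν ν ℂ) : Filter.Tendsto
    (fun n : ℕ => A + ((1 / ((n : ℝ) + 1) : ℝ) : ℂ) • B) Filter.atTop (nhds A) := by
  have h := (Complex.continuous_ofReal.tendsto 0).comp
    (tendsto_one_div_add_atTop_nhds_zero_nat (𝕜 := ℝ))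
  have := tendsto_const_nhds (x := A).add (h.smul_const B)
  simpa using this

/-- Data processing inequality for the `α`-fidelity. -/
lemma aFid_le_aFid_krausMap {α : ℝ} (hα : 1 / 2 ≤ α) (hα' : α < 1) {k : ℕ}
    {K : Fin k → Matrix κ ι ℂ} (hK : ∑ i, (K i)ᴴ * K i = 1) {ρ σ : Matrix ι ι ℂ}
    (hρ : ρ.PosSemidef) (hσ : σ.PosSemidef) :
    aFid α ρ σ ≤ aFid α (krausMap K ρ) (krausMap K σ) := by
  have hα0 : 0 < α := by linarith
  have hKρ := krausMap_posSemidef K hρ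
  have hKσ := krausMap_posSemidef K hσ
  have hc : ∀ n : ℕ, (0 : ℂ) < ((1 / ((n : ℝ) + 1) : ℝ) : ℂ) := fun n =>
    Complex.zero_lt_real.2 Nat.one_div_pos_of_nat
  have hρn : ∀ n : ℕ, (ρ + ((1 / ((n : ℝ) + 1) : ℝ) : ℂ) • (1 : Matrix ι ι ℂ)).PosDef :=
    fun n => PosDef.posSemidef_add hρ (PosDef.one.smul (hc n))
  have hτn : ∀ n : ℕ,
      (krausMap K σ + ((1 / ((n : ℝ) + 1) : ℝ) : ℂ) • (1 : Matrix κ κ ℂ)).PosDef :=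
    fun n => PosDef.posSemidef_add hKσ (PosDef.one.smul (hc n))
  have hrn : ∀ n : ℕ, (krausMap K ρ +
      ((1 / ((n : ℝ) + 1) : ℝ) : ℂ) • (krausMap K 1 + 1)).PosDef := fun n =>
    PosDef.posSemidef_add hKρ ((PosDef.posSemidef_add
      (krausMap_posSemidef K PosSemidef.one) PosDef.one).smul (hc n))
  refine le_of_tendsto_of_tendsto'
    (tendsto_aFid hα0 hα' (fun n => (hρn n).posSemidef) (fun _ => hσ) hρ hσ
      (tendsto_add_smul ρ 1) tendsto_const_nhds)
    (tendsto_aFid hα0 hα' (fun n => (hrn n).posSemidef) (fun n => (hτn n).posSemidef) hKρ hKσ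
      (tendsto_add_smul _ _) (tendsto_add_smul _ _)) fun n => ?_
  refine aFid_le_of_posDef hα hα' hK (hρn n) hσ (hrn n) (hτn n) ?_ ?_
  · rw [krausMap_add_smul, add_sub_add_left_eq_sub, ← smul_sub, add_sub_cancel_left]
    exact PosSemidef.one.smul (hc n).le
  · rw [add_sub_cancel_left]
    exact PosSemidef.one.smul (hc n).le

lemma aFid_nonneg {α : ℝ} {ρ σ : Matrix ι ι ℂ} (hρ : ρ.PosSemidef) (hσ : σ.PosSemidef) :
    0 ≤ aFid α ρ σ :=
  (Complex.le_def.1 (mpow_posSemidef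
    (mul_mul_posSemidef hρ (mpow_isHermitian hσ.isHermitian _)) α).trace_nonneg).1

lemma IsQChannel.exists_krausMap {E : Matrix ι ι ℂ → Matrix κ κ ℂ} (hE : IsQChannel E) :
    ∃ (k : ℕ) (K : Fin k → Matrix κ ι ℂ), E = krausMap K ∧ ∑ i, (K i)ᴴ * K i = 1 := by
  obtain ⟨k, K, hEK, hK⟩ := hE
  exact ⟨k, K, funext hEK, hK⟩

end DataProcessing

/-- the channel α-fidelity does not decrease under post-composition with
a quantum channel. -/
theorem stmt7 {n m : ℕ} (α : ℝ) (hα : (1 : ℝ) / 2 ≤ α) (hα' : α < 1)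
    (E₁ E₂ : Matrix (Fin n) (Fin n) ℂ → Matrix (Fin n) (Fin n) ℂ)
    (hE₁ : IsQChannel E₁) (hE₂ : IsQChannel E₂)
    (E : Matrix (Fin n) (Fin n) ℂ → Matrix (Fin m) (Fin m) ℂ) (hE : IsQChannel E) :
    chanFid α E₁ E₂ ≤ chanFid α (E ∘ E₁) (E ∘ E₂) := by
  obtain ⟨_, K₁, rfl, -⟩ := hE₁.exists_krausMap
  obtain ⟨_, K₂, rfl, -⟩ := hE₂.exists_krausMap
  obtain ⟨_, K, rfl, hK⟩ := hE.exists_krausMap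
  unfold chanFid
  by_cases h : ∃ ρ₁ ρ₂ : Matrix (Fin n) (Fin n) ℂ, IsDensity ρ₁ ∧ IsDensity ρ₂ ∧ 0 < aFid α ρ₁ ρ₂
  · obtain ⟨ρ₁, ρ₂, h₁, h₂, hpos⟩ := h
    refine le_csInf ⟨_, ρ₁, ρ₂, h₁, h₂, hpos, rfl⟩ ?_
    rintro _ ⟨σ₁, σ₂, hσ₁, hσ₂, hσ, rfl⟩
    refine le_trans (b := aFid α (krausMap K₁ σ₁) (krausMap K₂ σ₂) / aFid α σ₁ σ₂)
      (csInf_le ⟨0, ?_⟩ ⟨σ₁, σ₂, hσ₁, hσ₂, hσ, rfl⟩) (div_le_div_of_nonneg_right ?_ hσ.le)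
    · rintro _ ⟨τ₁, τ₂, hτ₁, hτ₂, hτ, rfl⟩
      exact div_nonneg (aFid_nonneg (krausMap_posSemidef K₁ hτ₁.1)
        (krausMap_posSemidef K₂ hτ₂.1)) hτ.le
    · exact aFid_le_aFid_krausMap hα hα' hK (krausMap_posSemidef K₁ hσ₁.1)
        (krausMap_posSemidef K₂ hσ₂.1)
  · have hempty : ∀ f : Matrix (Fin n) (Fin n) ℂ → Matrix (Fin n) (Fin n) ℂ → ℝ,
        {r : ℝ | ∃ ρ₁ ρ₂ : Matrix (Fin n) (Fin n) ℂ, IsDensity ρ₁ ∧ IsDensity ρ₂ ∧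
          0 < aFid α ρ₁ ρ₂ ∧ r = f ρ₁ ρ₂} = ∅ := fun f =>
      Set.eq_empty_of_forall_notMem fun _ ⟨ρ₁, ρ₂, h₁, h₂, h₃, _⟩ => h ⟨ρ₁, ρ₂, h₁, h₂, h₃⟩
    rw [hempty, hempty]
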